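/- arXiv:2303.06300 — 2 statements merged into one kernel-verified Lean document; each statement's English description precedes it below -/
import Mathlib

section
/- For n ≥ m ≥ 1, the total number of occurrences of the subword pattern 1^m 2 over all non-crossing partitions of [n] equals binom(2r−1, r+1), where r = n − m + 1. -/
/-- `l` is a restricted growth sequence (canonical sequential form of a set
partition): it starts with 1, all letters are ≥ 1, and each letter is at most
one more than the maximum of the preceding prefix. -/
def IsRGS (l : List ℕ) : Prop :=
  l.getD 0 1 = 1 ∧ (∀ x ∈ l, 1 ≤ x) ∧
  ∀ i, i + 1 < l.length → l.getD (i + 1) 0 ≤ (l.take (i + 1)).foldr max 0 + 1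

/-- `l` contains a (classical) occurrence of 1-2-1-2: a subsequence a,b,a,b with a < b. -/
def Crossing (l : List ℕ) : Prop :=
  ∃ i j k m : ℕ, i < j ∧ j < k ∧ k < m ∧ m < l.length ∧
    l.getD i 0 = l.getD k 0 ∧ l.getD j 0 = l.getD m 0 ∧ l.getD i 0 < l.getD j 0

/-- `l` is the canonical sequential form of a non-crossing partition of [n]. -/
def NCseq (n : ℕ) (l : List ℕ) : Prop := l.length = n ∧ IsRGS l ∧ ¬ Crossing l

/-- Two lists of the same length are order-isomorphic. -/
def OrdIso (s t : List ℕ) : Prop :=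
  s.length = t.length ∧ ∀ j k, j < s.length → k < s.length →
    (s.getD j 0 < s.getD k 0 ↔ t.getD j 0 < t.getD k 0)

/-- The subword pattern `τ` occurs in `l` starting at position `i`. -/
def occAt (τ l : List ℕ) (i : ℕ) : Prop := OrdIso τ ((l.drop i).take τ.length)

/-- The number of occurrences of the subword pattern `τ` in `l`. -/
noncomputable def occCount (τ l : List ℕ) : ℕ := Nat.card {i : ℕ // occAt τ l i}

/-- The total number of occurrences of the subword pattern `τ` over all
members of NC_n, counted with multiplicity (as marked occurrences). -/
noncomputable def totalOcc (n : ℕ) (τ : List ℕ) : ℕ :=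
  Nat.card {p : List ℕ × ℕ // NCseq n p.1 ∧ occAt τ p.1 p.2}

/-- `l` is the canonical sequential form of a non-crossing partition. -/
def IsNonCrossingSeq (l : List ℕ) : Prop := IsRGS l ∧ ¬ Crossing l

theorem le_foldr_max {l : List ℕ} {x : ℕ} (hx : x ∈ l) : x ≤ l.foldr max 0 := by
  induction l with
  | nil => simp at hx
  | cons a l ih => grind

theorem foldr_max_concat (l : List ℕ) (x : ℕ) :
    (l ++ [x]).foldr max 0 = max (l.foldr max 0) x := by
  induction l with
  | nil => simp
  | cons a l ih => simp_all [max_assoc]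

theorem isRGS_nil : IsRGS [] := by simp [IsRGS]

theorem isRGS_concat (p : List ℕ) (x : ℕ) :
    IsRGS (p ++ [x]) ↔ IsRGS p ∧ 1 ≤ x ∧ x ≤ p.foldr max 0 + 1 := by
  rcases eq_or_ne p [] with rfl | hp
  · simp [IsRGS]; omega
  have hlen : 0 < p.length := List.length_pos_iff.2 hp
  constructor
  · rintro ⟨h0, h1, h2⟩
    refine ⟨⟨?_, fun y hy => h1 y (by simp [hy]), fun i hi => ?_⟩, h1 x (by simp), ?_⟩
    · rwa [List.getD_append _ _ _ _ hlen] at h0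
    · have := h2 i (by simp; omega)
      rwa [List.getD_append _ _ _ _ hi, List.take_append_of_le_length hi.le] at this
    · have := h2 (p.length - 1) (by simp; omega)
      rw [Nat.sub_add_cancel hlen, List.take_append_of_le_length le_rfl] at this
      simpa using this
  · rintro ⟨⟨h0, h1, h2⟩, hx, hle⟩
    refine ⟨?_, ?_, fun i hi => ?_⟩
    · rwa [List.getD_append _ _ _ _ hlen]
    · grind
    · rcases lt_or_ge (i + 1) p.length with h | h
      · rw [List.getD_append _ _ _ _ h, List.take_append_of_le_length h.le]
        exact h2 i h
      · have : i + 1 = p.length := by simp at hi; omega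
        rw [this, List.take_append_of_le_length le_rfl]
        simpa using hle

/-- Appending the letter `x` to `p` completes a pattern 1-2-1-2 whose first three letters are
in `p`. -/
def Encloses (p : List ℕ) (x : ℕ) : Prop :=
  ∃ i j k : ℕ, i < j ∧ j < k ∧ k < p.length ∧
    p.getD i 0 = p.getD k 0 ∧ p.getD j 0 = x ∧ p.getD i 0 < x

theorem crossing_concat (p : List ℕ) (x : ℕ) :
    Crossing (p ++ [x]) ↔ Crossing p ∨ Encloses p x := by
  constructor
  · rintro ⟨i, j, k, m, hij, hjk, hkm, hm, h1, h2, h3⟩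
    have hk : k < p.length := by simp at hm; omega
    rw [List.getD_append _ _ _ i (by omega), List.getD_append _ _ _ k hk] at h1
    rw [List.getD_append _ _ _ i (by omega), List.getD_append _ _ _ j (by omega)] at h3
    rw [List.getD_append _ _ _ j (by omega)] at h2
    rcases lt_or_ge m p.length with h | h
    · rw [List.getD_append _ _ _ m h] at h2
      exact .inl ⟨i, j, k, m, hij, hjk, hkm, h, h1, h2, h3⟩
    · have hm' : m = p.length := by simp at hm; omega
      have hx : p.getD j 0 = x := by rw [h2, hm']; simp
      exact .inr ⟨i, j, k, hij, hjk, hk, h1, hx, hx ▸ h3⟩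
  · rintro (⟨i, j, k, m, hij, hjk, hkm, hm, h1, h2, h3⟩ | ⟨i, j, k, hij, hjk, hk, h1, h2, h3⟩)
    · refine ⟨i, j, k, m, hij, hjk, hkm, by simp; omega, ?_⟩
      rw [List.getD_append _ _ _ i (by omega), List.getD_append _ _ _ j (by omega),
        List.getD_append _ _ _ k (by omega), List.getD_append _ _ _ m hm]
      exact ⟨h1, h2, h3⟩
    · refine ⟨i, j, k, p.length, hij, hjk, hk, by simp, ?_⟩
      rw [List.getD_append _ _ _ i (by omega), List.getD_append _ _ _ j (by omega),
        List.getD_append _ _ _ k (by omega)]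
      exact ⟨h1, by rw [h2]; simp, h2 ▸ h3⟩

theorem isNonCrossingSeq_nil : IsNonCrossingSeq [] := by
  refine ⟨isRGS_nil, ?_⟩
  rintro ⟨i, j, k, m, -, -, -, hm, -⟩
  simp at hm

theorem isNonCrossingSeq_concat (p : List ℕ) (x : ℕ) :
    IsNonCrossingSeq (p ++ [x]) ↔
      IsNonCrossingSeq p ∧ 1 ≤ x ∧ x ≤ p.foldr max 0 + 1 ∧ ¬ Encloses p x := by
  simp only [IsNonCrossingSeq, isRGS_concat, crossing_concat]
  tauto

theorem IsNonCrossingSeq.of_append {p q : List ℕ} (h : IsNonCrossingSeq (p ++ q)) :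
    IsNonCrossingSeq p := by
  induction q using List.reverseRecOn with
  | nil => simpa using h
  | append_singleton q x ih =>
    rw [← List.append_assoc, isNonCrossingSeq_concat] at h
    exact ih h.1

theorem Encloses.le_foldr_max {p : List ℕ} {x : ℕ} (h : Encloses p x) : x ≤ p.foldr max 0 := by
  obtain ⟨i, j, k, -, hjk, hk, -, hx, -⟩ := h
  rw [List.getD_eq_getElem _ _ (hjk.trans hk)] at hx
  exact _root_.le_foldr_max (hx ▸ List.getElem_mem _)

theorem encloses_concat (p : List ℕ) (a x : ℕ) :
    Encloses (p ++ [a]) x ↔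
      Encloses p x ∨ a < x ∧ ∃ i j, i < j ∧ j < p.length ∧ p.getD i 0 = a ∧ p.getD j 0 = x := by
  constructor
  · rintro ⟨i, j, k, hij, hjk, hk, h1, h2, h3⟩
    have hj : j < p.length := by simp at hk; omega
    rw [List.getD_append _ _ _ i (by omega)] at h1 h3
    rw [List.getD_append _ _ _ j (by omega)] at h2
    rcases lt_or_ge k p.length with h | h
    · rw [List.getD_append _ _ _ k h] at h1
      exact .inl ⟨i, j, k, hij, hjk, h, h1, h2, h3⟩
    · have hk' : k = p.length := by simp at hk; omega
      have ha : p.getD i 0 = a := by rw [h1, hk']; simp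
      exact .inr ⟨ha ▸ h3, i, j, hij, hj, ha, h2⟩
  · rintro (⟨i, j, k, hij, hjk, hk, h1, h2, h3⟩ | ⟨hax, i, j, hij, hj, h1, h2⟩)
    · refine ⟨i, j, k, hij, hjk, by simp; omega, ?_⟩
      rw [List.getD_append _ _ _ i (by omega), List.getD_append _ _ _ j (by omega),
        List.getD_append _ _ _ k (by omega)]
      exact ⟨h1, h2, h3⟩
    · refine ⟨i, j, p.length, hij, hj, by simp, ?_⟩
      rw [List.getD_append _ _ _ i (by omega), List.getD_append _ _ _ j (by omega)]
      exact ⟨by rw [h1]; simp, h2, h1 ▸ hax⟩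

theorem IsRGS.mem_of_le {p : List ℕ} (h : IsRGS p) {x : ℕ} (hx : 1 ≤ x)
    (hx' : x ≤ p.foldr max 0) : x ∈ p := by
  induction p using List.reverseRecOn with
  | nil => simp at hx'; omega
  | append_singleton p a ih =>
    rw [isRGS_concat] at h
    rw [foldr_max_concat] at hx'
    rcases le_or_gt x (p.foldr max 0) with hle | hlt
    · simp [ih h.1 hle]
    · have : x = a := by omega
      simp [this]

/-- In a restricted growth sequence letters first appear in increasing order. -/
theorem IsRGS.exists_pair {p : List ℕ} (h : IsRGS p) {a x : ℕ} (ha : 1 ≤ a) (hax : a < x)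
    (hx : x ∈ p) : ∃ i j, i < j ∧ j < p.length ∧ p.getD i 0 = a ∧ p.getD j 0 = x := by
  induction p using List.reverseRecOn with
  | nil => simp at hx
  | append_singleton p b ih =>
    rw [isRGS_concat] at h
    by_cases hxp : x ∈ p
    · obtain ⟨i, j, hij, hj, h1, h2⟩ := ih h.1 hxp
      refine ⟨i, j, hij, by simp; omega, ?_⟩
      rw [List.getD_append _ _ _ i (by omega), List.getD_append _ _ _ j hj]
      exact ⟨h1, h2⟩
    · obtain rfl : x = b := by simpa [hxp] using hx
      obtain ⟨i, hi, hia⟩ := List.getElem_of_mem (h.1.mem_of_le ha (by omega))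
      refine ⟨i, p.length, hi, by simp, ?_, by simp⟩
      rw [List.getD_append _ _ _ i hi, List.getD_eq_getElem _ _ hi, hia]

open Classical in
/-- The letters which extend `p` to a longer non-crossing sequence. -/
noncomputable def nextLetters (p : List ℕ) : Finset ℕ :=
  (Finset.range (p.foldr max 0 + 2)).filter fun x => IsNonCrossingSeq (p ++ [x])

theorem mem_nextLetters {p : List ℕ} {x : ℕ} :
    x ∈ nextLetters p ↔ IsNonCrossingSeq (p ++ [x]) := by
  simp only [nextLetters, Finset.mem_filter, Finset.mem_range, and_iff_right_iff_imp,
    isNonCrossingSeq_concat]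
  omega

theorem IsNonCrossingSeq.foldr_max_succ_mem_nextLetters {p : List ℕ} (h : IsNonCrossingSeq p) :
    p.foldr max 0 + 1 ∈ nextLetters p := by
  rw [mem_nextLetters, isNonCrossingSeq_concat]
  exact ⟨h, by omega, le_rfl, fun he => by have := he.le_foldr_max; omega⟩

theorem le_of_mem_nextLetters {p : List ℕ} {x : ℕ} (h : x ∈ nextLetters p) :
    x ≤ p.foldr max 0 + 1 :=
  ((isNonCrossingSeq_concat p x).1 (mem_nextLetters.1 h)).2.2.1

theorem mem_nextLetters_concat {p : List ℕ} {a x : ℕ} (ha : a ∈ nextLetters p) :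
    x ∈ nextLetters (p ++ [a]) ↔
      x = (p ++ [a]).foldr max 0 + 1 ∨ x ∈ nextLetters p ∧ x ≤ a := by
  rw [mem_nextLetters] at ha
  have ha' := (isNonCrossingSeq_concat p a).1 ha
  constructor
  · rw [mem_nextLetters, isNonCrossingSeq_concat, foldr_max_concat, encloses_concat,
      mem_nextLetters, isNonCrossingSeq_concat p x]
    rintro ⟨-, h1, h2, h3⟩
    push Not at h3
    rcases le_or_gt x a with hxa | hax
    · exact .inr ⟨⟨ha'.1, h1, by omega, h3.1⟩, hxa⟩
    · left
      by_contra hne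
      obtain ⟨i, j, hij, hj, hi', hj'⟩ := ha'.1.1.exists_pair ha'.2.1 hax
        (ha'.1.1.mem_of_le h1 (by omega))
      exact h3.2 hax i j hij hj hi' hj'
  · rintro (rfl | ⟨hx, hxa⟩)
    · exact ha.foldr_max_succ_mem_nextLetters
    · rw [mem_nextLetters, isNonCrossingSeq_concat] at hx
      rw [mem_nextLetters, isNonCrossingSeq_concat, foldr_max_concat, encloses_concat]
      exact ⟨ha, hx.2.1, by omega, fun h => h.elim hx.2.2.2 fun h => by omega⟩

theorem card_nextLetters_concat {p : List ℕ} {a : ℕ} (ha : a ∈ nextLetters p) :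
    (nextLetters (p ++ [a])).card = ((nextLetters p).filter (· ≤ a)).card + 1 := by
  have : nextLetters (p ++ [a]) =
      insert ((p ++ [a]).foldr max 0 + 1) ((nextLetters p).filter (· ≤ a)) := by
    ext x
    simp [mem_nextLetters_concat ha]
  rw [this, Finset.card_insert_of_notMem]
  simp only [Finset.mem_filter, foldr_max_concat]
  omega

theorem sum_card_filter_le (s : Finset ℕ) (f : ℕ → ℕ) :
    ∑ x ∈ s, f (s.filter (· ≤ x)).card = ∑ i ∈ Finset.range s.card, f (i + 1) := by
  induction s using Finset.induction_on_max with
  | empty => simp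
  | insert a s hs ih =>
    have ha : a ∉ s := fun h => (hs a h).false
    rw [Finset.sum_insert ha, Finset.card_insert_of_notMem ha, Finset.sum_range_succ, ← ih,
      add_comm]
    congr 1
    · refine Finset.sum_congr rfl fun x hx => ?_
      rw [Finset.filter_insert, if_neg (by simpa using hs x hx)]
    · rw [Finset.filter_true_of_mem, Finset.card_insert_of_notMem ha]
      intro x hx
      rcases Finset.mem_insert.1 hx with rfl | h
      exacts [le_rfl, (hs x h).le]

theorem sum_nextLetters (p : List ℕ) (f : ℕ → ℕ) :
    ∑ x ∈ nextLetters p, f (nextLetters (p ++ [x])).card =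
      ∑ i ∈ Finset.range (nextLetters p).card, f (i + 2) := by
  rw [← sum_card_filter_le _ fun i => f (i + 1)]
  exact Finset.sum_congr rfl fun x hx => by rw [card_nextLetters_concat hx]

/-- The number of ways to append `k` letters to a non-crossing sequence which has `t + 2`
possible next letters. -/
def extensionCount : ℕ → ℕ → ℕ
  | 0, _ => 1
  | k + 1, t => ∑ u ∈ Finset.range (t + 2), extensionCount k u

/-- The number of ways to append letters to a non-crossing sequence with `t + 2` possible next
letters so that an ascent is marked, `k` being the number of letters appended besides the
repetitions of the lower letter of that ascent. -/
def markedExtensionCount : ℕ → ℕ → ℕ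
  | 0, _ => 0
  | k + 1, t => extensionCount k (t + 1) + ∑ u ∈ Finset.range (t + 2), markedExtensionCount k u

theorem extensionCount_succ_succ (k t : ℕ) : extensionCount (k + 1) (t + 1) =
    extensionCount (k + 1) t + extensionCount k (t + 2) :=
  Finset.sum_range_succ _ _

theorem markedExtensionCount_succ_succ (k t : ℕ) :
    markedExtensionCount (k + 1) (t + 1) + extensionCount k (t + 1) =
      markedExtensionCount (k + 1) t + markedExtensionCount k (t + 2) +
        extensionCount k (t + 2) := by
  simp only [markedExtensionCount]
  rw [Finset.sum_range_succ _ (t + 2)]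
  ring

theorem extensionCount_succ_add_choose (k t : ℕ) :
    extensionCount (k + 1) t + (2 * k + t + 3).choose k = (2 * k + t + 3).choose (k + 1) := by
  induction k generalizing t with
  | zero => simp [extensionCount]
  | succ k ihk =>
    induction t with
    | zero =>
      have h0 := ihk 0
      have h1 := ihk 1
      rw [extensionCount]
      simp only [Finset.sum_range_succ, Finset.sum_range_zero]
      have e : ∀ j, (2 * k + 5).choose (j + 1) =
        (2 * k + 4).choose j + (2 * k + 4).choose (j + 1) := fun j => Nat.choose_succ_succ _ _
      have e' : ∀ j, (2 * k + 4).choose (j + 1) =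
        (2 * k + 3).choose j + (2 * k + 3).choose (j + 1) := fun j => Nat.choose_succ_succ _ _
      have hs : (2 * k + 3).choose (k + 2) = (2 * k + 3).choose (k + 1) :=
        Nat.choose_symm_of_eq_add (by omega)
      have a1 := e k
      have a2 := e (k + 1)
      have a3 := e' k
      have a4 := e' (k + 1)
      rw [show 2 * (k + 1) + 0 + 3 = 2 * k + 5 by ring]
      rw [show 2 * k + 0 + 3 = 2 * k + 3 by ring] at h0
      rw [show 2 * k + 1 + 3 = 2 * k + 4 by ring] at h1
      simp only [add_assoc, Nat.reduceAdd] at *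
      omega
    | succ t iht =>
      have h := ihk (t + 2)
      have hr := extensionCount_succ_succ (k + 1) t
      have a1 := Nat.choose_succ_succ (2 * k + t + 5) k
      have a2 := Nat.choose_succ_succ (2 * k + t + 5) (k + 1)
      rw [hr]
      rw [show 2 * (k + 1) + (t + 1) + 3 = (2 * k + t + 5).succ by omega]
      rw [show 2 * (k + 1) + t + 3 = 2 * k + t + 5 by omega] at iht
      rw [show 2 * k + (t + 2) + 3 = 2 * k + t + 5 by omega] at h
      simp only [Nat.succ_eq_add_one, add_assoc, Nat.reduceAdd] at *
      omega

theorem markedExtensionCount_eq (k t : ℕ) :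
    markedExtensionCount (k + 2) t =
      (2 * k + t + 5).choose (k + 1) + t * (2 * k + t + 4).choose k := by
  induction k generalizing t with
  | zero =>
    simp [markedExtensionCount, extensionCount]
    ring
  | succ k ihk =>
    induction t with
    | zero =>
      have h0 := ihk 0
      have h1 := ihk 1
      have h2 := extensionCount_succ_add_choose (k + 1) 1
      rw [markedExtensionCount]
      simp only [Finset.sum_range_succ, Finset.sum_range_zero]
      have a1 := Nat.choose_succ_succ (2 * k + 6) (k + 1)
      have a2 := Nat.choose_succ_succ (2 * k + 5) k
      rw [show 2 * (k + 1) + 0 + 5 = (2 * k + 6).succ by omega]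
      rw [show 2 * (k + 1) + 1 + 3 = 2 * k + 6 by omega] at h2
      rw [show 2 * k + 1 + 5 = 2 * k + 6 by omega, show 2 * k + 1 + 4 = 2 * k + 5 by omega] at h1
      simp only [Nat.succ_eq_add_one, add_assoc, Nat.reduceAdd, zero_mul, one_mul] at *
      omega
    | succ t iht =>
      have h := ihk (t + 2)
      have hr := markedExtensionCount_succ_succ (k + 2) t
      have hr' := extensionCount_succ_succ (k + 1) (t + 1)
      have h2 := extensionCount_succ_add_choose k (t + 3)
      have a1 := Nat.choose_succ_succ (2 * k + t + 7) (k + 1)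
      have a2 := Nat.choose_succ_succ (2 * k + t + 6) k
      have a3 := Nat.choose_succ_succ (2 * k + t + 6) (k + 1)
      rw [show 2 * (k + 1) + (t + 1) + 5 = (2 * k + t + 7).succ by omega,
        show 2 * (k + 1) + (t + 1) + 4 = (2 * k + t + 6).succ by omega]
      rw [show 2 * (k + 1) + t + 5 = 2 * k + t + 7 by omega,
        show 2 * (k + 1) + t + 4 = 2 * k + t + 6 by omega] at iht
      rw [show 2 * k + (t + 2) + 5 = 2 * k + t + 7 by omega,
        show 2 * k + (t + 2) + 4 = 2 * k + t + 6 by omega] at h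
      rw [show 2 * k + (t + 3) + 3 = 2 * k + t + 6 by omega] at h2
      simp only [Nat.succ_eq_add_one, add_assoc, Nat.reduceAdd] at *
      nlinarith

theorem markedExtensionCount_zero_right (k : ℕ) :
    markedExtensionCount k 0 = (2 * k + 1).choose (k + 2) := by
  rcases k with _ | _ | k
  · simp [markedExtensionCount]
  · simp [markedExtensionCount, extensionCount]
  · rw [markedExtensionCount_eq, zero_mul, add_zero]
    exact Nat.choose_symm_of_eq_add (by omega)

theorem ordIso_replicate_append_iff (d : ℕ) (u : List ℕ) :
    OrdIso (List.replicate (d + 1) 1 ++ [2]) u ↔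
      ∃ a b, a < b ∧ u = List.replicate (d + 1) a ++ [b] := by
  have key : ∀ a b j : ℕ, j < d + 2 →
      (List.replicate (d + 1) a ++ [b]).getD j 0 = if j < d + 1 then a else b := by
    intro a b j hj
    split_ifs with h
    · rw [List.getD_append _ _ _ _ (by simpa using h), List.getD_replicate _ h]
    · obtain rfl : j = d + 1 := by omega
      rw [List.getD_append_right _ _ _ _ (by simp)]
      simp
  constructor
  · rintro ⟨hlen, h⟩
    simp only [List.length_append, List.length_replicate, List.length_singleton] at hlen h
    refine ⟨u.getD 0 0, u.getD (d + 1) 0, ?_, ?_⟩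
    · have := h 0 (d + 1) (by omega) (by omega)
      rw [key _ _ _ (by omega), key _ _ _ (by omega)] at this
      simpa using this
    · refine List.ext_getElem (by simp; omega) fun j hj hj' => ?_
      rw [← List.getD_eq_getElem _ 0 hj, ← List.getD_eq_getElem _ 0 hj', key _ _ _ (by omega)]
      split_ifs with hjd
      · have h1 := h 0 j (by omega) (by omega)
        have h2 := h j 0 (by omega) (by omega)
        rw [key _ _ _ (by omega), key _ _ _ (by omega)] at h1 h2
        simp only [hjd, if_true, Nat.zero_lt_succ, lt_irrefl, false_iff] at h1 h2
        omega
      · rw [show j = d + 1 by omega]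
  · rintro ⟨a, b, hab, rfl⟩
    refine ⟨by simp, fun j k hj hk => ?_⟩
    simp only [List.length_append, List.length_replicate, List.length_singleton] at hj hk
    rw [key _ _ _ hj, key _ _ _ hk, key _ _ _ hj, key _ _ _ hk]
    split_ifs <;> omega

theorem occAt_cons_zero_iff (d a : ℕ) (q : List ℕ) :
    occAt (List.replicate (d + 1) 1 ++ [2]) (a :: q) 0 ↔
      ∃ b q', a < b ∧ q = List.replicate d a ++ b :: q' := by
  have hτ : (List.replicate (d + 1) 1 ++ [2]).length = d + 2 := by simp
  rw [occAt, ordIso_replicate_append_iff, hτ, List.drop_zero]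
  constructor
  · rintro ⟨a', b, hab, h⟩
    rw [List.take_succ_cons, List.replicate_succ, List.cons_append, List.cons.injEq] at h
    obtain ⟨rfl, h⟩ := h
    refine ⟨b, q.drop (d + 1), hab, ?_⟩
    conv_lhs => rw [← List.take_append_drop (d + 1) q, h]
    simp
  · rintro ⟨b, q', hab, rfl⟩
    refine ⟨a, b, hab, ?_⟩
    rw [List.take_succ_cons, List.replicate_succ, List.cons_append,
      show List.replicate d a ++ b :: q' = (List.replicate d a ++ [b]) ++ q' by simp,
      List.take_left' (by simp)]

theorem nextLetters_concat_concat {p : List ℕ} {a : ℕ} (ha : a ∈ nextLetters p) :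
    a ∈ nextLetters (p ++ [a]) ∧ nextLetters (p ++ [a] ++ [a]) = nextLetters (p ++ [a]) := by
  have ha' : a ∈ nextLetters (p ++ [a]) := (mem_nextLetters_concat ha).2 (.inr ⟨ha, le_rfl⟩)
  refine ⟨ha', ?_⟩
  ext x
  rw [mem_nextLetters_concat ha', mem_nextLetters_concat ha, foldr_max_concat _ a,
    foldr_max_concat, max_assoc, max_self]
  grind

theorem nextLetters_append_replicate {p : List ℕ} {a : ℕ} (ha : a ∈ nextLetters p) (d : ℕ) :
    a ∈ nextLetters (p ++ List.replicate d a) ∧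
      nextLetters (p ++ List.replicate (d + 1) a) = nextLetters (p ++ [a]) := by
  induction d with
  | zero => simpa using ha
  | succ d ih =>
    have h := nextLetters_concat_concat ih.1
    rw [List.append_assoc, ← List.replicate_succ'] at h
    refine ⟨h.1, ?_⟩
    rw [List.replicate_succ', ← List.append_assoc, h.2, ih.2]

theorem two_le_card_nextLetters_concat {p : List ℕ} {a : ℕ} (ha : a ∈ nextLetters p) :
    2 ≤ (nextLetters (p ++ [a])).card := by
  rw [card_nextLetters_concat ha]
  have : 0 < ((nextLetters p).filter (· ≤ a)).card :=
    Finset.card_pos.2 ⟨a, by simp [ha]⟩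
  omega

/-- The ways to append `k` letters to `p`. -/
abbrev Extension (p : List ℕ) (k : ℕ) : Type :=
  {q : List ℕ // q.length = k ∧ IsNonCrossingSeq (p ++ q)}

/-- The ways to append `k` letters to `p ++ [a]` and to mark an occurrence of `τ` which starts
no earlier than the letter `a`. -/
abbrev MarkedExtension (τ p : List ℕ) (a k : ℕ) : Type :=
  {z : List ℕ × ℕ // z.1.length = k ∧ IsNonCrossingSeq (p ++ a :: z.1) ∧ occAt τ (a :: z.1) z.2}

theorem extension_succ_bijective (p : List ℕ) (k : ℕ) :
    Function.Bijective
      (fun z : (Σ x : nextLetters p, Extension (p ++ [x.1]) k) =>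
        (⟨z.1.1 :: z.2.1, by simpa using z.2.2⟩ : Extension p (k + 1))) := by
  constructor
  · rintro ⟨⟨x, hx⟩, q, hq⟩ ⟨⟨y, hy⟩, r, hr⟩ h
    simp only [Subtype.mk.injEq, List.cons.injEq] at h
    obtain ⟨rfl, rfl⟩ := h
    rfl
  · rintro ⟨_ | ⟨x, q⟩, hlen, hq⟩
    · simp at hlen
    · have hq' : IsNonCrossingSeq (p ++ [x] ++ q) := by simpa using hq
      exact ⟨⟨⟨x, mem_nextLetters.2 hq'.of_append⟩, q, by simpa using hlen, hq'⟩, rfl⟩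

theorem card_extension (k : ℕ) {p : List ℕ} (hp : IsNonCrossingSeq p)
    (h2 : 2 ≤ (nextLetters p).card) :
    Finite (Extension p k) ∧
      Nat.card (Extension p k) = extensionCount k ((nextLetters p).card - 2) := by
  induction k generalizing p with
  | zero =>
    have : Unique (Extension p 0) :=
      { default := ⟨[], by simpa using hp⟩
        uniq := fun q => Subtype.ext (List.length_eq_zero_iff.1 q.2.1) }
    exact ⟨inferInstance, by simp [extensionCount]⟩
  | succ k ih =>
    have ih' := fun x : nextLetters p =>
      ih (mem_nextLetters.1 x.2) (two_le_card_nextLetters_concat x.2)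
    have := fun x => (ih' x).1
    have e := Equiv.ofBijective _ (extension_succ_bijective p k)
    refine ⟨Finite.of_equiv _ e, ?_⟩
    rw [← Nat.card_congr e, Nat.card_sigma, Finset.sum_congr rfl fun x _ => (ih' x).2,
      Finset.sum_coe_sort (nextLetters p)
        fun x => extensionCount k ((nextLetters (p ++ [x])).card - 2),
      sum_nextLetters p fun c => extensionCount k (c - 2), extensionCount, Nat.sub_add_cancel h2]
    rfl

theorem initialMark_bijective {p : List ℕ} {a : ℕ} (ha : a ∈ nextLetters p) (d k : ℕ) :
    Function.Bijective
      (fun z : Extension (p ++ List.replicate (d + 1) a ++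
          [(p ++ List.replicate (d + 1) a).foldr max 0 + 1]) k =>
        (⟨List.replicate d a ++ ((p ++ List.replicate (d + 1) a).foldr max 0 + 1) :: z.1, by
          refine ⟨by simp [z.2.1]; omega, ?_, ?_⟩
          · simpa [List.replicate_succ] using z.2.2
          · rw [occAt_cons_zero_iff]
            exact ⟨_, _, Nat.lt_succ_of_le (le_foldr_max (by simp)), rfl⟩⟩ :
          {q : List ℕ // q.length = k + d + 1 ∧ IsNonCrossingSeq (p ++ a :: q) ∧
            occAt (List.replicate (d + 1) 1 ++ [2]) (a :: q) 0})) := by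
  constructor
  · rintro ⟨q, hq⟩ ⟨r, hr⟩ h
    simpa using h
  · rintro ⟨q, hlen, hq, ho⟩
    obtain ⟨b, q', hab, rfl⟩ := (occAt_cons_zero_iff d a q).1 ho
    have hb : IsNonCrossingSeq (p ++ List.replicate (d + 1) a ++ [b] ++ q') := by
      simpa [List.replicate_succ] using hq
    have hb' := mem_nextLetters.2 hb.of_append
    rw [List.replicate_succ', ← List.append_assoc,
      mem_nextLetters_concat (nextLetters_append_replicate ha d).1] at hb'
    obtain rfl : b = (p ++ List.replicate (d + 1) a).foldr max 0 + 1 := by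
      rw [List.replicate_succ', ← List.append_assoc]
      exact hb'.resolve_right fun h => absurd h.2 (by omega)
    exact ⟨⟨q', by simp at hlen; omega, hb⟩, rfl⟩

theorem card_initialMark {p : List ℕ} {a : ℕ} (ha : a ∈ nextLetters p) (d k : ℕ) :
    Finite {q : List ℕ // q.length = k + d + 1 ∧ IsNonCrossingSeq (p ++ a :: q) ∧
        occAt (List.replicate (d + 1) 1 ++ [2]) (a :: q) 0} ∧
      Nat.card {q : List ℕ // q.length = k + d + 1 ∧ IsNonCrossingSeq (p ++ a :: q) ∧
        occAt (List.replicate (d + 1) 1 ++ [2]) (a :: q) 0} =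
      extensionCount k ((nextLetters (p ++ [a])).card - 2 + 1) := by
  have e := Equiv.ofBijective _ (initialMark_bijective ha d k)
  obtain ⟨ha', hN⟩ := nextLetters_append_replicate ha d
  have hv : IsNonCrossingSeq (p ++ List.replicate (d + 1) a) := by
    rw [List.replicate_succ', ← List.append_assoc]
    exact mem_nextLetters.1 ha'
  have hmem := hv.foldr_max_succ_mem_nextLetters
  have hc := card_extension k (mem_nextLetters.1 hmem) (two_le_card_nextLetters_concat hmem)
  have := hc.1
  refine ⟨Finite.of_equiv _ e, ?_⟩
  rw [← Nat.card_congr e, hc.2, card_nextLetters_concat hmem,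
    Finset.filter_true_of_mem fun x hx => le_of_mem_nextLetters hx, hN]
  have := two_le_card_nextLetters_concat ha
  congr 1
  omega

theorem markedExtension_succ_bijective (τ p : List ℕ) (a k : ℕ) :
    Function.Bijective
      (Sum.elim
        (fun z : {q : List ℕ // q.length = k + 1 ∧ IsNonCrossingSeq (p ++ a :: q) ∧
            occAt τ (a :: q) 0} => (⟨(z.1, 0), z.2⟩ : MarkedExtension τ p a (k + 1)))
        (fun z : (Σ x : nextLetters (p ++ [a]), MarkedExtension τ (p ++ [a]) x.1 k) =>
          (⟨(z.1.1 :: z.2.1.1, z.2.1.2 + 1), by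
            obtain ⟨x, ⟨q, i⟩, h1, h2, h3⟩ := z
            exact ⟨by simpa using h1, by simpa using h2, h3⟩⟩ :
            MarkedExtension τ p a (k + 1)))) := by
  constructor
  · rintro (⟨q, hq⟩ | ⟨⟨x, hx⟩, ⟨q, i⟩, hq⟩) (⟨r, hr⟩ | ⟨⟨y, hy⟩, ⟨r, j⟩, hr⟩) h
    · simpa using h
    · simp at h
    · simp at h
    · simp only [Sum.elim_inr, Subtype.mk.injEq, Prod.mk.injEq, List.cons.injEq,
        Nat.add_right_cancel_iff] at h
      obtain ⟨⟨rfl, rfl⟩, rfl⟩ := h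
      rfl
  · rintro ⟨⟨q, _ | i⟩, hlen, hq, ho⟩
    · exact ⟨.inl ⟨q, hlen, hq, ho⟩, rfl⟩
    · rcases q with _ | ⟨x, q⟩
      · simp at hlen
      · have hq' : IsNonCrossingSeq (p ++ [a] ++ [x] ++ q) := by simpa using hq
        exact ⟨.inr ⟨⟨x, mem_nextLetters.2 hq'.of_append⟩, (q, i),
          by simpa using hlen, by simpa using hq', ho⟩, rfl⟩

theorem card_markedExtension (d k : ℕ) {p : List ℕ} {a : ℕ} (ha : a ∈ nextLetters p) :
    Finite (MarkedExtension (List.replicate (d + 1) 1 ++ [2]) p a (k + d)) ∧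
      Nat.card (MarkedExtension (List.replicate (d + 1) 1 ++ [2]) p a (k + d)) =
        markedExtensionCount k ((nextLetters (p ++ [a])).card - 2) := by
  induction k generalizing p a with
  | zero =>
    have : IsEmpty (MarkedExtension (List.replicate (d + 1) 1 ++ [2]) p a (0 + d)) := by
      refine ⟨?_⟩
      rintro ⟨⟨q, i⟩, hlen, -, ho⟩
      have := ho.1
      simp only [List.length_append, List.length_replicate, List.length_take,
        List.length_drop, List.length_cons] at this hlen
      omega
    exact ⟨inferInstance, Nat.card_of_isEmpty⟩
  | succ k ih =>
    rw [show k + 1 + d = k + d + 1 by omega]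
    have hc := card_initialMark ha d k
    have ih' := fun x : nextLetters (p ++ [a]) => ih x.2
    have := fun x => (ih' x).1
    have := hc.1
    have e := Equiv.ofBijective _
      (markedExtension_succ_bijective (List.replicate (d + 1) 1 ++ [2]) p a (k + d))
    refine ⟨Finite.of_equiv _ e, ?_⟩
    rw [← Nat.card_congr e, Nat.card_sum, hc.2, Nat.card_sigma,
      Finset.sum_congr rfl fun x _ => (ih' x).2,
      Finset.sum_coe_sort (nextLetters (p ++ [a]))
        fun x => markedExtensionCount k ((nextLetters (p ++ [a] ++ [x])).card - 2),
      sum_nextLetters (p ++ [a]) fun c => markedExtensionCount k (c - 2), markedExtensionCount,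
      Nat.sub_add_cancel (two_le_card_nextLetters_concat ha)]
    rfl

theorem nextLetters_nil : nextLetters [] = {1} := by
  ext x
  have : ¬ Encloses [] x := by
    rintro ⟨i, j, k, -, -, hk, -⟩
    simp at hk
  rw [mem_nextLetters, isNonCrossingSeq_concat, Finset.mem_singleton]
  simp only [isNonCrossingSeq_nil, this, List.foldr_nil, not_false_eq_true, true_and, and_true]
  omega

theorem totalOcc_bijective (τ : List ℕ) (k : ℕ) :
    Function.Bijective
      (fun z : MarkedExtension τ [] 1 k =>
        (⟨(1 :: z.1.1, z.1.2), ⟨by simp [z.2.1], z.2.2.1⟩, z.2.2.2⟩ :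
          {p : List ℕ × ℕ // NCseq (k + 1) p.1 ∧ occAt τ p.1 p.2})) := by
  constructor
  · rintro ⟨⟨q, i⟩, hq⟩ ⟨⟨r, j⟩, hr⟩ h
    simpa using h
  · rintro ⟨⟨_ | ⟨x, q⟩, i⟩, ⟨hlen, hq⟩, ho⟩
    · simp at hlen
    · obtain rfl : x = 1 := hq.1.1
      exact ⟨⟨(q, i), by simpa using hlen, hq, ho⟩, rfl⟩

/-- For n ≥ m ≥ 1, the total number of occurrences of the subword 1^m 2 over
all members of NC_n equals binom(2r−1, r+1), where r = n − m + 1. -/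
theorem stmt3 (n m : ℕ) (hm : 1 ≤ m) (hmn : m ≤ n) :
    totalOcc n (List.replicate m 1 ++ [2]) =
      Nat.choose (2 * (n + 1 - m) - 1) ((n + 1 - m) + 1) := by
  obtain ⟨d, rfl⟩ : ∃ d, m = d + 1 := ⟨m - 1, by omega⟩
  obtain ⟨k, rfl⟩ : ∃ k, n = k + d + 1 := ⟨n - (d + 1), by omega⟩
  have h1 : 1 ∈ nextLetters [] := by simp [nextLetters_nil]
  have hcard : (nextLetters ([] ++ [1])).card = 2 := by
    rw [card_nextLetters_concat h1, nextLetters_nil]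
    rfl
  rw [totalOcc, ← Nat.card_congr (Equiv.ofBijective _ (totalOcc_bijective _ (k + d))),
    (card_markedExtension d k h1).2, hcard, markedExtensionCount_zero_right]
  congr 1 <;> omega
end

section
/- For all n ≥ 0, the subword patterns 231 and 221 are equidistributed on non-crossing partitions of [n]: for every k, the number of π ∈ NC_n with exactly k occurrences of 231 equals the number with exactly k occurrences of 221. -/
/-- The largest letter of a word, `0` for the empty word. -/
def maxLetter (r : List ℕ) : ℕ := r.foldr max 0

/-- The letters which may be repeated without creating a crossing after the word `r.reverse`. -/
def openLetters : List ℕ → Finset ℕ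
  | [] => ∅
  | x :: r => insert x ((openLetters r).filter (· < x))

/-- Reversed canonical sequential forms of non-crossing partitions: each letter is either open
or new. -/
def IsRevNC : List ℕ → Prop
  | [] => True
  | x :: r => (x ∈ openLetters r ∨ x = maxLetter r + 1) ∧ IsRevNC r

/-- The numbers of open letters along a reversed word. -/
def heights : List ℕ → List ℕ
  | [] => []
  | x :: r => (openLetters (x :: r)).card :: heights r

/-- Reversed sequences of positive integers starting with `1` and increasing by at most `1`
at each step. -/
def IsRevCatalan : List ℕ → Prop
  | [] => True
  | a :: t => 1 ≤ a ∧ a ≤ t.headD 0 + 1 ∧ IsRevCatalan t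

/-- The number of consecutive triples `a, b, c` of the word `r.reverse` satisfying `P`. -/
def revTripleCount (P : ℕ → ℕ → ℕ → Bool) : List ℕ → ℕ
  | c :: b :: a :: t => (if P a b c then 1 else 0) + revTripleCount P (b :: a :: t)
  | _ => 0

/-- Exchange the consecutive triples `a, a, c` and `a, a + 1, c` with `c < a` in `r.reverse`. -/
def swapPeaks : List ℕ → List ℕ
  | c :: b :: a :: t =>
    if c < a ∧ a ≤ b ∧ b ≤ a + 1 then c :: (2 * a + 1 - b) :: swapPeaks (a :: t)
    else c :: swapPeaks (b :: a :: t)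
  | r => r

section Sublists

theorem cons_sublist_iff_exists_getElem? {a : ℕ} {s l : List ℕ} :
    (a :: s).Sublist l ↔ ∃ i, l[i]? = some a ∧ s.Sublist (l.drop (i + 1)) := by
  induction l with
  | nil => simp
  | cons x l ih =>
    constructor
    · intro h
      cases h with
      | cons _ h =>
        obtain ⟨i, h₁, h₂⟩ := ih.1 h
        exact ⟨i + 1, by simpa using h₁, by simpa using h₂⟩
      | cons_cons _ h => exact ⟨0, by simp, by simpa using h⟩
    · rintro ⟨i, h₁, h₂⟩
      cases i with
      | zero =>
        obtain rfl : x = a := by simpa using h₁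
        exact List.Sublist.cons_cons _ (by simpa using h₂)
      | succ i => exact List.Sublist.cons _ (ih.2 ⟨i, by simpa using h₁, by simpa using h₂⟩)

theorem crossing_iff_sublist {l : List ℕ} :
    Crossing l ↔ ∃ a b, a < b ∧ [a, b, a, b].Sublist l := by
  simp only [cons_sublist_iff_exists_getElem?, List.drop_drop, List.getElem?_drop,
    List.nil_sublist, and_true, Crossing]
  constructor
  · rintro ⟨i, j, k, m, hij, hjk, hkm, hm, h₁, h₂, h₃⟩
    refine ⟨l.getD i 0, l.getD j 0, h₃, i, ?_, j - (i + 1), ?_, k - (j + 1), ?_, m - (k + 1), ?_⟩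
    · rw [List.getD_eq_getElem _ _ (by omega), List.getElem?_eq_getElem]
    · rw [List.getD_eq_getElem _ _ (by omega), List.getElem?_eq_some_iff]
      exact ⟨by omega, by congr 1; omega⟩
    · rw [h₁, List.getD_eq_getElem _ _ (by omega), List.getElem?_eq_some_iff]
      exact ⟨by omega, by congr 1; omega⟩
    · rw [h₂, List.getD_eq_getElem _ _ (by omega), List.getElem?_eq_some_iff]
      exact ⟨by omega, by congr 1; omega⟩
  · rintro ⟨a, b, hab, i, hi, j, hj, k, hk, m, hm⟩
    refine ⟨i, i + 1 + j, i + 1 + (j + 1) + k, _, ?_, ?_, ?_,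
      (List.getElem?_eq_some_iff.1 hm).1, ?_, ?_, ?_⟩
    · omega
    · omega
    · omega
    all_goals simp only [List.getD_eq_getElem?_getD, hi, hj, hk, hm, Option.getD_some, hab]

theorem crossing_reverse_cons {x : ℕ} {r : List ℕ} :
    Crossing (x :: r).reverse ↔ Crossing r.reverse ∨ ∃ a < x, [a, x, a].Sublist r := by
  have key : ∀ r : List ℕ, Crossing r.reverse ↔ ∃ a b, a < b ∧ [b, a, b, a].Sublist r := by
    intro r
    rw [crossing_iff_sublist]
    refine exists_congr fun a => exists_congr fun b => and_congr_right fun _ => ?_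
    rw [← List.reverse_sublist]
    simp
  rw [key, key]
  simp only [List.sublist_cons_iff]
  constructor
  · rintro ⟨a, b, hab, h | ⟨s, hs, h⟩⟩
    · exact Or.inl ⟨a, b, hab, h⟩
    · obtain ⟨rfl, rfl⟩ := List.cons.inj hs
      exact Or.inr ⟨a, hab, h⟩
  · rintro (⟨a, b, hab, h⟩ | ⟨a, hab, h⟩)
    · exact ⟨a, b, hab, Or.inl h⟩
    · exact ⟨a, x, hab, Or.inr ⟨_, rfl, h⟩⟩

end Sublists

section CanonicalForm

@[simp] theorem maxLetter_cons (x : ℕ) (r : List ℕ) :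
    maxLetter (x :: r) = max x (maxLetter r) := rfl

theorem le_maxLetter {x : ℕ} {r : List ℕ} (h : x ∈ r) : x ≤ maxLetter r := by
  induction r with
  | nil => simp at h
  | cons y r ih =>
    rcases List.mem_cons.1 h with rfl | h
    · simp
    · exact (ih h).trans (by simp)

theorem maxLetter_append_singleton (l : List ℕ) (x : ℕ) :
    maxLetter (l ++ [x]) = max x (maxLetter l) := by
  induction l with
  | nil => rfl
  | cons y l ih => simp only [List.cons_append, maxLetter_cons, ih]; omega

theorem maxLetter_reverse (r : List ℕ) : maxLetter r.reverse = maxLetter r := by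
  induction r with
  | nil => rfl
  | cons y l ih => simp [maxLetter_append_singleton, ih]

theorem isRGS_append_singleton {l : List ℕ} {x : ℕ} :
    IsRGS (l ++ [x]) ↔ IsRGS l ∧ 1 ≤ x ∧ x ≤ maxLetter l + 1 := by
  rcases List.eq_nil_or_concat l with rfl | ⟨l', y, hl⟩
  · simp only [IsRGS, maxLetter]
    simp
    omega
  have hpos : 0 < l.length := by simp [hl]
  unfold IsRGS
  rw [List.getD_append _ _ _ _ hpos]
  constructor
  · rintro ⟨h₁, h₂, h₃⟩
    refine ⟨⟨h₁, fun z hz => h₂ z (by simp [hz]), fun i hi => ?_⟩, h₂ x (by simp), ?_⟩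
    · have := h₃ i (by simp; omega)
      rwa [List.getD_append _ _ _ _ hi, List.take_append_of_le_length (by omega)] at this
    · have := h₃ (l.length - 1) (by simp; omega)
      rw [Nat.sub_add_cancel hpos, List.getD_append_right _ _ _ _ le_rfl] at this
      simpa [maxLetter] using this
  · rintro ⟨⟨h₁, h₂, h₃⟩, hx, hx'⟩
    refine ⟨h₁, ?_, fun i hi => ?_⟩
    · intro z hz
      rcases List.mem_append.1 hz with hz | hz
      · exact h₂ z hz
      · rwa [List.mem_singleton.1 hz]
    · rw [List.length_append, List.length_singleton] at hi
      rw [List.take_append_of_le_length (by omega)]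
      rcases Nat.lt_or_ge (i + 1) l.length with h | h
      · rw [List.getD_append _ _ _ _ h]
        exact h₃ i h
      · rw [List.getD_append_right _ _ _ _ h, show i + 1 = l.length by omega]
        simpa [maxLetter] using hx'

theorem isRGS_reverse_cons {x : ℕ} {r : List ℕ} :
    IsRGS (x :: r).reverse ↔ IsRGS r.reverse ∧ 1 ≤ x ∧ x ≤ maxLetter r + 1 := by
  rw [List.reverse_cons, isRGS_append_singleton, maxLetter_reverse]

theorem mem_of_isRGS_reverse {x : ℕ} {r : List ℕ} (h : IsRGS r.reverse) (hx : 1 ≤ x)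
    (hx' : x ≤ maxLetter r) : x ∈ r := by
  induction r with
  | nil => simp [maxLetter] at hx'; omega
  | cons y r ih =>
    obtain ⟨hr, -, hy⟩ := isRGS_reverse_cons.1 h
    rw [maxLetter_cons] at hx'
    by_cases hxy : x = y
    · simp [hxy]
    · exact List.mem_cons_of_mem _ (ih hr (by omega))

theorem pair_sublist_of_isRGS_reverse {x y : ℕ} {r : List ℕ} (h : IsRGS r.reverse)
    (hx : x ∈ r) (hy : 1 ≤ y) (hyx : y < x) : [x, y].Sublist r := by
  induction r with
  | nil => simp at hx
  | cons z r ih =>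
    obtain ⟨hr, -, hz⟩ := isRGS_reverse_cons.1 h
    rcases List.mem_cons.1 hx with rfl | hx
    · exact List.Sublist.cons_cons _
        (List.singleton_sublist.2 (mem_of_isRGS_reverse hr hy (by omega)))
    · exact (ih hr hx).cons _

theorem mem_openLetters_or_new_iff {x : ℕ} {r : List ℕ} (h : IsRGS r.reverse)
    (hc : ¬ Crossing r.reverse) (hx : 1 ≤ x) (hx' : x ≤ maxLetter r + 1) :
    (x ∈ openLetters r ∨ x = maxLetter r + 1) ↔ ¬ ∃ a < x, [a, x, a].Sublist r := by
  induction r with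
  | nil =>
    simp [maxLetter] at hx' ⊢
    omega
  | cons y r ih =>
    obtain ⟨hr, hy, hy'⟩ := isRGS_reverse_cons.1 h
    rw [crossing_reverse_cons, not_or] at hc
    obtain ⟨hc, hcy⟩ := hc
    simp only [openLetters, Finset.mem_insert, Finset.mem_filter]
    rw [maxLetter_cons] at hx' ⊢
    have hcons : ∀ a, a ≠ y → ([a, x, a].Sublist (y :: r) ↔ [a, x, a].Sublist r) := by
      intro a ha
      simp [List.sublist_cons_iff, ha]
    rcases lt_trichotomy x y with hxy | rfl | hxy
    · have hiff : (∃ a < x, [a, x, a].Sublist (y :: r)) ↔ ∃ a < x, [a, x, a].Sublist r :=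
        exists_congr fun a => and_congr_right fun ha => hcons a (by omega)
      rw [hiff, ← ih hr hc (by omega)]
      have h₁ : x ≠ y := by omega
      have h₂ : x ≠ max y (maxLetter r) + 1 := by omega
      have h₃ : x ≠ maxLetter r + 1 := by omega
      simp [h₁, h₂, h₃, hxy]
    · have hiff : (∃ a < x, [a, x, a].Sublist (x :: r)) ↔ ∃ a < x, [a, x, a].Sublist r :=
        exists_congr fun a => and_congr_right fun ha => hcons a (by omega)
      rw [hiff]
      simp [hcy]
    · have h₁ : x ≠ y := by omega
      have h₂ : ¬ x < y := by omega
      simp only [h₁, h₂, and_false, or_false, false_or]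
      constructor
      · rintro hm ⟨a, -, ha⟩
        have : x ≤ maxLetter (y :: r) := le_maxLetter (ha.subset (by simp))
        rw [maxLetter_cons] at this
        omega
      · intro hn
        by_contra hm
        refine hn ⟨y, hxy, List.Sublist.cons_cons _ ?_⟩
        exact pair_sublist_of_isRGS_reverse hr
          (mem_of_isRGS_reverse hr hx (by omega)) hy hxy

theorem mem_of_mem_openLetters {x : ℕ} {r : List ℕ} (h : x ∈ openLetters r) : x ∈ r := by
  induction r with
  | nil => simp [openLetters] at h
  | cons y r ih =>
    simp only [openLetters, Finset.mem_insert, Finset.mem_filter] at h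
    rcases h with rfl | ⟨h, -⟩
    · simp
    · exact List.mem_cons_of_mem _ (ih h)

theorem isRGS_and_not_crossing_reverse_iff {r : List ℕ} :
    (IsRGS r.reverse ∧ ¬ Crossing r.reverse) ↔ IsRevNC r := by
  induction r with
  | nil => simp [IsRGS, Crossing, IsRevNC]
  | cons x r ih =>
    rw [isRGS_reverse_cons, crossing_reverse_cons, IsRevNC, ← ih, not_or]
    constructor
    · rintro ⟨⟨hr, hx, hx'⟩, hc, hn⟩
      exact ⟨(mem_openLetters_or_new_iff hr hc hx hx').2 hn, hr, hc⟩
    · rintro ⟨h, hr, hc⟩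
      have hx : 1 ≤ x ∧ x ≤ maxLetter r + 1 := by
        rcases h with h | h
        · have hm := mem_of_mem_openLetters h
          exact ⟨hr.2.1 x (by simpa using hm), (le_maxLetter hm).trans (by omega)⟩
        · omega
      exact ⟨⟨hr, hx⟩, hc, (mem_openLetters_or_new_iff hr hc hx.1 hx.2).1 h⟩

end CanonicalForm

section Heights

theorem card_openLetters_cons (x : ℕ) (r : List ℕ) :
    (openLetters (x :: r)).card = ((openLetters r).filter (· < x)).card + 1 := by
  rw [openLetters, Finset.card_insert_of_notMem (by simp)]

theorem card_filter_lt_lt_iff {S : Finset ℕ} {x y : ℕ} (h : x ∈ S ∨ ∀ s ∈ S, s < x)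
    (hxy : x ∈ S ∨ y ∈ S) :
    (S.filter (· < x)).card < (S.filter (· < y)).card ↔ x < y := by
  constructor
  · intro hlt
    by_contra! hle
    exact absurd (Finset.card_le_card
      (Finset.monotone_filter_right S fun s _ (hs : s < y) => hs.trans_le hle)) (by omega)
  · intro hlt
    have hx : x ∈ S := by
      rcases h with h | h
      · exact h
      · rcases hxy with hx | hy
        · exact hx
        · exact absurd (h y hy) (by omega)
    refine Finset.card_lt_card (Finset.ssubset_iff_of_subset
      (Finset.monotone_filter_right S fun s _ (hs : s < x) => hs.trans hlt) |>.2 ?_)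
    exact ⟨x, by simp [hx, hlt], by simp⟩

theorem exists_card_filter_lt_eq (S : Finset ℕ) {a : ℕ} (ha : a < S.card) :
    ∃ x ∈ S, (S.filter (· < x)).card = a := by
  induction S using Finset.induction_on_max with
  | empty => simp at ha
  | insert m S hm ih =>
    have hmS : m ∉ S := fun h => lt_irrefl _ (hm m h)
    rw [Finset.card_insert_of_notMem hmS] at ha
    rcases Nat.lt_or_ge a S.card with h | h
    · obtain ⟨x, hx, hxa⟩ := ih h
      refine ⟨x, Finset.mem_insert_of_mem hx, ?_⟩
      rwa [Finset.filter_insert, if_neg (not_lt.2 (hm x hx).le)]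
    · refine ⟨m, Finset.mem_insert_self _ _, ?_⟩
      rw [Finset.filter_insert, if_neg (lt_irrefl _), Finset.filter_true_of_mem hm]
      omega

theorem lt_of_mem_openLetters {s : ℕ} {r : List ℕ} (h : s ∈ openLetters r) :
    s < maxLetter r + 1 :=
  Nat.lt_succ_of_le (le_maxLetter (mem_of_mem_openLetters h))

theorem mem_or_forall_lt_of_isRevNC_cons {x : ℕ} {r : List ℕ} (h : IsRevNC (x :: r)) :
    x ∈ openLetters r ∨ ∀ s ∈ openLetters r, s < x :=
  h.1.imp id fun hx _ hs => (lt_of_mem_openLetters hs).trans_eq hx.symm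

theorem length_heights (r : List ℕ) : (heights r).length = r.length := by
  induction r with
  | nil => rfl
  | cons x r ih => simp [heights, ih]

theorem headD_heights (r : List ℕ) : (heights r).headD 0 = (openLetters r).card := by
  cases r <;> simp [heights, openLetters]

theorem isRevCatalan_heights (r : List ℕ) : IsRevCatalan (heights r) := by
  induction r with
  | nil => trivial
  | cons x r ih =>
    refine ⟨?_, ?_, ih⟩
    · rw [card_openLetters_cons]; omega
    · rw [card_openLetters_cons, headD_heights]
      exact Nat.succ_le_succ (Finset.card_filter_le _ _)

theorem heights_injOn {r r' : List ℕ} (h : IsRevNC r) (h' : IsRevNC r')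
    (heq : heights r = heights r') : r = r' := by
  induction r generalizing r' with
  | nil =>
    cases r' with
    | nil => rfl
    | cons => simp [heights] at heq
  | cons x r ih =>
    cases r' with
    | nil => simp [heights] at heq
    | cons y r' =>
      simp only [heights, List.cons.injEq, card_openLetters_cons, add_left_inj] at heq
      obtain rfl := ih h.2 h'.2 heq.2
      have hx := mem_or_forall_lt_of_isRevNC_cons h
      have hy := mem_or_forall_lt_of_isRevNC_cons h'
      by_cases hxy : x ∈ openLetters r ∨ y ∈ openLetters r
      · have h₁ := card_filter_lt_lt_iff hx hxy
        have h₂ := card_filter_lt_lt_iff hy hxy.symm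
        rw [show x = y by omega]
      · rw [not_or] at hxy
        rw [h.1.resolve_left hxy.1, h'.1.resolve_left hxy.2]

theorem exists_heights_eq {t : List ℕ} (ht : IsRevCatalan t) :
    ∃ r, IsRevNC r ∧ heights r = t := by
  induction t with
  | nil => exact ⟨[], trivial, rfl⟩
  | cons a t ih =>
    obtain ⟨h₁, h₂, h₃⟩ := ht
    obtain ⟨r, hr, rfl⟩ := ih h₃
    rw [headD_heights] at h₂
    obtain ⟨x, hx, hxa⟩ : ∃ x, (x ∈ openLetters r ∨ x = maxLetter r + 1) ∧
        ((openLetters r).filter (· < x)).card = a - 1 := by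
      rcases Nat.lt_or_ge (a - 1) (openLetters r).card with h | h
      · obtain ⟨x, hx, hxa⟩ := exists_card_filter_lt_eq _ h
        exact ⟨x, Or.inl hx, hxa⟩
      · refine ⟨_, Or.inr rfl, ?_⟩
        rw [Finset.filter_true_of_mem fun s hs => lt_of_mem_openLetters hs]
        omega
    refine ⟨x :: r, ⟨hx, hr⟩, ?_⟩
    rw [heights, card_openLetters_cons, hxa, Nat.sub_add_cancel h₁]

theorem card_openLetters_lt_iff {a b : ℕ} {t : List ℕ} (h : IsRevNC (b :: a :: t)) :
    ((openLetters (b :: a :: t)).card < (openLetters (a :: t)).card ↔ b < a) ∧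
      ((openLetters (a :: t)).card < (openLetters (b :: a :: t)).card ↔ a < b) := by
  have hfilter : (openLetters (a :: t)).filter (· < a) = (openLetters t).filter (· < a) := by
    ext s
    simp only [openLetters, Finset.mem_filter, Finset.mem_insert]
    constructor
    · rintro ⟨rfl | h, h'⟩
      · omega
      · exact h
    · rintro h
      exact ⟨Or.inr h, h.2⟩
  have ha : a ∈ openLetters (a :: t) := by simp [openLetters]
  have hb := mem_or_forall_lt_of_isRevNC_cons h
  rw [card_openLetters_cons b, card_openLetters_cons a, ← hfilter, Nat.succ_lt_succ_iff,
    Nat.succ_lt_succ_iff]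
  exact ⟨card_filter_lt_lt_iff hb (Or.inr ha),
    card_filter_lt_lt_iff (Or.inl ha) (Or.inl ha)⟩

theorem card_openLetters_lt_iff_of_le {a b c : ℕ} {t : List ℕ} (h : IsRevNC (c :: b :: a :: t))
    (hab : a ≤ b) :
    (openLetters (c :: b :: a :: t)).card < (openLetters (a :: t)).card ↔ c < a := by
  have ha : a ∈ openLetters (b :: a :: t) := by
    simp only [openLetters, Finset.mem_insert, Finset.mem_filter, true_or, true_and]
    omega
  have hfilter : (openLetters (b :: a :: t)).filter (· < a) =
      (openLetters t).filter (· < a) := by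
    ext s
    simp only [openLetters, Finset.mem_filter, Finset.mem_insert]
    constructor
    · rintro ⟨rfl | ⟨rfl | h, -⟩, h'⟩
      · omega
      · omega
      · exact h
    · rintro h
      exact ⟨Or.inr ⟨Or.inr h, by omega⟩, h.2⟩
  rw [card_openLetters_cons c, card_openLetters_cons a, ← hfilter, Nat.succ_lt_succ_iff]
  exact card_filter_lt_lt_iff (mem_or_forall_lt_of_isRevNC_cons h) (Or.inr ha)

theorem revTripleCount_heights {P Q : ℕ → ℕ → ℕ → Bool} {r : List ℕ} (h : IsRevNC r)
    (hPQ : ∀ a b c t, IsRevNC (c :: b :: a :: t) →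
      P a b c = Q (openLetters (a :: t)).card (openLetters (b :: a :: t)).card
        (openLetters (c :: b :: a :: t)).card) :
    revTripleCount P r = revTripleCount Q (heights r) := by
  induction r with
  | nil => rfl
  | cons c r ih =>
    match r, h, ih with
    | [], _, _ => rfl
    | [b], _, _ => rfl
    | b :: a :: t, h, ih =>
      rw [revTripleCount, ih h.2, hPQ a b c t h]
      simp only [heights, revTripleCount]

theorem revTripleCount_heights_231 {r : List ℕ} (h : IsRevNC r) :
    revTripleCount (fun a b c => decide (c < a ∧ a < b)) r =
      revTripleCount (fun a b c => decide (c < a ∧ b = a + 1)) (heights r) := by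
  refine revTripleCount_heights h fun a b c t h => ?_
  rw [decide_eq_decide]
  have h₁ := card_openLetters_lt_iff h.2
  have h₂ := (isRevCatalan_heights (b :: a :: t)).2.1
  have h₃ := card_openLetters_lt_iff_of_le h
  rw [headD_heights] at h₂
  constructor
  · rintro ⟨hca, hab⟩
    have := h₁.2.2 hab
    exact ⟨(h₃ hab.le).2 hca, by omega⟩
  · rintro ⟨hca, hab⟩
    have hab' := h₁.2.1 (by omega)
    exact ⟨(h₃ hab'.le).1 hca, hab'⟩

theorem revTripleCount_heights_221 {r : List ℕ} (h : IsRevNC r) :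
    revTripleCount (fun a b c => decide (c < a ∧ b = a)) r =
      revTripleCount (fun a b c => decide (c < a ∧ b = a)) (heights r) := by
  refine revTripleCount_heights h fun a b c t h => ?_
  rw [decide_eq_decide]
  have h₁ := card_openLetters_lt_iff h.2
  have h₃ := card_openLetters_lt_iff_of_le h
  constructor
  · rintro ⟨hca, hab⟩
    exact ⟨(h₃ hab.ge).2 hca, by omega⟩
  · rintro ⟨hca, hab⟩
    have hab' : b = a := by omega
    exact ⟨(h₃ hab'.ge).1 hca, hab'⟩

end Heights

section Occurrences

theorem occCount_reverse {τ : List ℕ} {P : ℕ → ℕ → ℕ → Bool}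
    (hP : ∀ l i, occAt τ l i ↔
      i + 2 < l.length ∧ P (l.getD i 0) (l.getD (i + 1) 0) (l.getD (i + 2) 0))
    (r : List ℕ) : occCount τ r.reverse = revTripleCount P r := by
  have hsum : ∀ l : List ℕ, occCount τ l = ∑ i ∈ Finset.range (l.length - 2),
      if P (l.getD i 0) (l.getD (i + 1) 0) (l.getD (i + 2) 0) then 1 else 0 := by
    intro l
    rw [Finset.sum_boole, Nat.cast_id, occCount]
    refine Nat.subtype_card _ fun i => ?_
    rw [hP, Finset.mem_filter, Finset.mem_range]
    exact and_congr_left fun _ => by omega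
  rw [hsum]
  induction r with
  | nil => rfl
  | cons c r ih =>
    match r, ih with
    | [], _ => rfl
    | [b], _ => rfl
    | b :: a :: t, ih =>
      rw [revTripleCount, ← ih, add_comm]
      generalize hs : t.reverse = s
      have e₁ : (c :: b :: a :: t).reverse = s ++ [a, b, c] := by simp [hs]
      have e₂ : (b :: a :: t).reverse = s ++ [a, b] := by simp [hs]
      rw [e₁, e₂]
      have l₁ : (s ++ [a, b, c]).length - 2 = s.length + 1 := by simp
      have l₂ : (s ++ [a, b]).length - 2 = s.length := by simp
      rw [l₁, l₂, Finset.sum_range_succ]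
      congr 1
      · refine Finset.sum_congr rfl fun i hi => ?_
        rw [Finset.mem_range] at hi
        have happ : s ++ [a, b, c] = (s ++ [a, b]) ++ [c] := by simp
        rw [happ, List.getD_append (s ++ [a, b]) _ _ _ (by simp; omega),
          List.getD_append (s ++ [a, b]) _ _ _ (by simp; omega),
          List.getD_append (s ++ [a, b]) _ _ _ (by simp; omega)]
      · simp

theorem occAt_triple_iff {x y z : ℕ} {l : List ℕ} {i : ℕ} :
    occAt [x, y, z] l i ↔ i + 2 < l.length ∧
      OrdIso [x, y, z] [l.getD i 0, l.getD (i + 1) 0, l.getD (i + 2) 0] := by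
  have hlen : ((l.drop i).take 3).length = min 3 (l.length - i) := by simp
  by_cases h : i + 2 < l.length
  · have htake : (l.drop i).take 3 = [l.getD i 0, l.getD (i + 1) 0, l.getD (i + 2) 0] := by
      rw [List.drop_eq_getElem_cons (by omega), List.drop_eq_getElem_cons (by omega),
        List.drop_eq_getElem_cons h, List.getD_eq_getElem _ _ (by omega),
        List.getD_eq_getElem _ _ (by omega), List.getD_eq_getElem _ _ h]
      rfl
    simp only [occAt, List.length_cons, List.length_nil, Nat.zero_add, Nat.reduceAdd, htake, h,
      true_and]
  · refine iff_of_false (fun ho => ?_) fun ho => h ho.1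
    have := ho.1
    simp only [List.length_cons, List.length_nil, Nat.zero_add, Nat.reduceAdd, hlen] at this
    omega

theorem ordIso_triple_iff {x y z a b c : ℕ} :
    OrdIso [x, y, z] [a, b, c] ↔ (x < y ↔ a < b) ∧ (x < z ↔ a < c) ∧ (y < x ↔ b < a) ∧
      (y < z ↔ b < c) ∧ (z < x ↔ c < a) ∧ (z < y ↔ c < b) := by
  constructor
  · rintro ⟨-, h⟩
    exact ⟨h 0 1 (by simp) (by simp), h 0 2 (by simp) (by simp), h 1 0 (by simp) (by simp),
      h 1 2 (by simp) (by simp), h 2 0 (by simp) (by simp), h 2 1 (by simp) (by simp)⟩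
  · rintro ⟨h₁, h₂, h₃, h₄, h₅, h₆⟩
    refine ⟨rfl, fun j k hj hk => ?_⟩
    simp only [List.length_cons, List.length_nil] at hj hk
    interval_cases j <;> interval_cases k <;> simp [*]

theorem occCount_231_reverse (r : List ℕ) :
    occCount [2, 3, 1] r.reverse =
      revTripleCount (fun a b c => decide (c < a ∧ a < b)) r := by
  refine occCount_reverse (fun l i => ?_) r
  rw [occAt_triple_iff, ordIso_triple_iff, decide_eq_true_iff]
  exact and_congr_right fun _ => by omega

theorem occCount_221_reverse (r : List ℕ) :
    occCount [2, 2, 1] r.reverse =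
      revTripleCount (fun a b c => decide (c < a ∧ b = a)) r := by
  refine occCount_reverse (fun l i => ?_) r
  rw [occAt_triple_iff, ordIso_triple_iff, decide_eq_true_iff]
  exact and_congr_right fun _ => by omega

end Occurrences

section SwapPeaks

theorem swapPeaks_cons_cons (b a : ℕ) (t : List ℕ) :
    ∃ a' t', swapPeaks (b :: a :: t) = b :: a' :: t' ∧ (a' = a ∨ b < a ∧ b < a') := by
  induction t generalizing a b with
  | nil => exact ⟨a, [], by simp [swapPeaks], Or.inl rfl⟩
  | cons d t ih =>
    rw [swapPeaks]
    split_ifs with h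
    · exact ⟨_, _, rfl, Or.inr (by omega)⟩
    · obtain ⟨d', t', h', -⟩ := ih a d
      exact ⟨a, d' :: t', by rw [h'], Or.inl rfl⟩

theorem exists_swapPeaks_cons (a : ℕ) (t : List ℕ) :
    ∃ t', swapPeaks (a :: t) = a :: t' := by
  cases t with
  | nil => exact ⟨[], by simp [swapPeaks]⟩
  | cons b t =>
    obtain ⟨b', t', h, -⟩ := swapPeaks_cons_cons a b t
    exact ⟨_, h⟩

theorem length_swapPeaks (r : List ℕ) : (swapPeaks r).length = r.length := by
  fun_induction swapPeaks r <;> simp_all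

theorem swapPeaks_swapPeaks (r : List ℕ) : swapPeaks (swapPeaks r) = r := by
  fun_induction swapPeaks r with
  | case1 c b a t h ih =>
    obtain ⟨t', ht⟩ := exists_swapPeaks_cons a t
    rw [ht] at ih ⊢
    rw [swapPeaks, if_pos (by omega), ih]
    congr 2
    omega
  | case2 c b a t h ih =>
    obtain ⟨a', t', ht, ha⟩ := swapPeaks_cons_cons b a t
    rw [ht] at ih ⊢
    rw [swapPeaks, if_neg (by omega), ih]
  | case3 r h =>
    rw [swapPeaks]
    exact h

theorem isRevCatalan_swapPeaks {r : List ℕ} (hr : IsRevCatalan r) :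
    IsRevCatalan (swapPeaks r) := by
  fun_induction swapPeaks r with
  | case1 c b a t h ih =>
    obtain ⟨h₁, h₂, h₃, h₄, h₅⟩ := hr
    obtain ⟨t', ht⟩ := exists_swapPeaks_cons a t
    have h₆ := ih h₅
    rw [ht] at h₆ ⊢
    simp only [List.headD_cons] at h₂ h₄
    exact ⟨h₁, by simp only [List.headD_cons]; omega, by omega,
      by simp only [List.headD_cons]; omega, h₆⟩
  | case2 c b a t h ih =>
    obtain ⟨t', ht⟩ := exists_swapPeaks_cons b (a :: t)
    have h₆ := ih hr.2.2
    rw [ht] at h₆ ⊢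
    exact ⟨hr.1, hr.2.1, h₆⟩
  | case3 r h => exact hr

theorem revTripleCount_cons_cons_of_le {P : ℕ → ℕ → ℕ → Bool}
    (hP : ∀ a b c, P a b c → c < b) {b a : ℕ} (hab : a ≤ b) (t : List ℕ) :
    revTripleCount P (b :: a :: t) = revTripleCount P (a :: t) := by
  cases t with
  | nil => rfl
  | cons d t =>
    rw [revTripleCount]
    have : ¬ P d a b := fun h => absurd (hP _ _ _ h) (by omega)
    simp [this]

theorem revTripleCount_swapPeaks (r : List ℕ) :
    revTripleCount (fun a b c => decide (c < a ∧ b = a)) (swapPeaks r) =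
      revTripleCount (fun a b c => decide (c < a ∧ b = a + 1)) r := by
  fun_induction swapPeaks r with
  | case1 c b a t h ih =>
    obtain ⟨t', ht⟩ := exists_swapPeaks_cons a t
    rw [ht] at ih ⊢
    rw [revTripleCount, revTripleCount,
      revTripleCount_cons_cons_of_le (by simp; omega) (by omega),
      revTripleCount_cons_cons_of_le (by simp; omega) (by omega), ih]
    congr 1
    simp only [decide_eq_true_eq]
    exact if_congr (by omega) rfl rfl
  | case2 c b a t h ih =>
    obtain ⟨a', t', ht, ha⟩ := swapPeaks_cons_cons b a t
    rw [ht] at ih ⊢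
    rw [revTripleCount, revTripleCount, ih]
    congr 1
    simp only [decide_eq_true_eq]
    exact if_congr (by omega) rfl rfl
  | case3 r h =>
    match r, h with
    | [], _ => rfl
    | [b], _ => rfl
    | [b, a], _ => rfl
    | c :: b :: a :: t, h => exact absurd rfl (h c b a t)

end SwapPeaks

theorem ncseq_reverse_iff {n : ℕ} {r : List ℕ} :
    NCseq n r.reverse ↔ r.length = n ∧ IsRevNC r := by
  rw [NCseq, isRGS_and_not_crossing_reverse_iff, List.length_reverse]

/-- Statistics on non-crossing partitions and on Catalan sequences that correspond under
`heights` have the same distribution. -/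
theorem card_ncseq_eq_card_isRevCatalan {f g : List ℕ → ℕ}
    (hfg : ∀ r, IsRevNC r → f r.reverse = g (heights r)) (n k : ℕ) :
    Nat.card {l : List ℕ // NCseq n l ∧ f l = k} =
      Nat.card {t : List ℕ // (t.length = n ∧ IsRevCatalan t) ∧ g t = k} := by
  have hrev : ∀ l, NCseq n l → l.reverse.length = n ∧ IsRevNC l.reverse := fun l hl =>
    ncseq_reverse_iff.1 (by rwa [List.reverse_reverse])
  refine Nat.card_congr (Equiv.ofBijective
    (fun l => ⟨heights l.1.reverse, ⟨?_, isRevCatalan_heights _⟩, ?_⟩) ⟨?_, ?_⟩)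
  · rw [length_heights]
    exact (hrev _ l.2.1).1
  · rw [← hfg _ (hrev _ l.2.1).2, List.reverse_reverse]
    exact l.2.2
  · rintro ⟨l, hl, _⟩ ⟨l', hl', _⟩ heq
    exact Subtype.ext (List.reverse_injective
      (heights_injOn (hrev l hl).2 (hrev l' hl').2 (congrArg Subtype.val heq)))
  · rintro ⟨t, ⟨htn, ht⟩, htk⟩
    obtain ⟨r, hr, rfl⟩ := exists_heights_eq ht
    rw [length_heights] at htn
    exact ⟨⟨r.reverse, ncseq_reverse_iff.2 ⟨htn, hr⟩, by rw [hfg r hr, htk]⟩,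
      Subtype.ext (by simp)⟩

/-- The subwords 231 and 221 are equidistributed on NC_n. -/
theorem stmt9 (n k : ℕ) :
    Nat.card {l : List ℕ // NCseq n l ∧ occCount [2, 3, 1] l = k} =
      Nat.card {l : List ℕ // NCseq n l ∧ occCount [2, 2, 1] l = k} := by
  rw [card_ncseq_eq_card_isRevCatalan fun r hr =>
      (occCount_231_reverse r).trans (revTripleCount_heights_231 hr),
    card_ncseq_eq_card_isRevCatalan fun r hr =>
      (occCount_221_reverse r).trans (revTripleCount_heights_221 hr)]
  have hinv : Function.Involutive swapPeaks := swapPeaks_swapPeaks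
  refine Nat.card_congr (hinv.toPerm.subtypeEquiv fun t => ?_)
  rw [hinv.coe_toPerm, length_swapPeaks, revTripleCount_swapPeaks]
  refine and_congr_left fun _ => and_congr_right fun _ =>
    ⟨isRevCatalan_swapPeaks, fun h => ?_⟩
  rw [← swapPeaks_swapPeaks t]
  exact isRevCatalan_swapPeaks h
end
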